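/- arXiv:2602.24063 — 3 statements merged into one kernel-verified Lean document; each statement's English description precedes it below -/
import Mathlib

section
/- Let D be a dimer configuration (perfect matching) on the Aztec diamond graph of size n, and let P = (s_0, s_1, ..., s_k) be a directed path in the associated south Temperleyan forest, where each vertex s_i is a south vertex and each step s_{i+1} - s_i lies in {(±2, ±2)}. Define the height h(v) of a vertex v as the average of the heights of its four incident faces. Then h(s_{k-1}) - h(s_0) = L - R, where L is the number of left turns and R the number of right turns made by the path P. -/
/-!
STATEMENT 5: For a dimer configuration `D` on the Aztec diamond of size `n`, with
Thurston height function `h` on faces, along any directed path `P = (s₀,…,s_k)` in the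
south Temperleyan forest (steps `(±2,±2)` coming from dimers at the south vertices), the
vertex height `h(v)` (average of the four incident face heights) satisfies
`h(s_{k-1}) - h(s₀) = L - R` where `L`, `R` are the numbers of left and right turns of `P`.
-/

open scoped Classical

noncomputable section

/-- The four diagonal unit steps. -/
def diagDirs : Set (ℤ × ℤ) := {(1, 1), (1, -1), (-1, 1), (-1, -1)}

def WhiteV (v : ℤ × ℤ) : Prop := Odd v.1 ∧ Even v.2
def BlackV (v : ℤ × ℤ) : Prop := Even v.1 ∧ Odd v.2

/-- South vertices: white vertices lying south of their adjacent `a`-face. -/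
def SouthV (v : ℤ × ℤ) : Prop := WhiteV v ∧ (4 : ℤ) ∣ (v.1 + v.2 - 1)

def inBox (n : ℤ) (v : ℤ × ℤ) : Prop := |v.1| ≤ n ∧ |v.2| ≤ n

/-- A dimer configuration (perfect matching) of the Aztec diamond of size `n`, recorded
as a set of (white, black) pairs of matched vertices. -/
def IsAztecMatching (n : ℤ) (M : Set ((ℤ × ℤ) × (ℤ × ℤ))) : Prop :=
  (∀ p ∈ M, WhiteV p.1 ∧ (p.2 - p.1) ∈ diagDirs ∧ inBox n p.1 ∧ inBox n p.2) ∧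
  (∀ v, WhiteV v → inBox n v → ∃! b, (v, b) ∈ M) ∧
  (∀ b, BlackV b → inBox n b → ∃! v, (v, b) ∈ M)

/-- The edge `{v, w}` is covered by a dimer of `M`. -/
def covered (M : Set ((ℤ × ℤ) × (ℤ × ℤ))) (v w : ℤ × ℤ) : Prop :=
  (v, w) ∈ M ∨ (w, v) ∈ M

/-- Height increment across an edge: `+1` if the edge is not covered, `-3` if it is. -/
def stepVal (M : Set ((ℤ × ℤ) × (ℤ × ℤ))) (v w : ℤ × ℤ) : ℤ :=
  if covered M v w then -3 else 1

/-- Thurston's rule counterclockwise around a white vertex `c`. -/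
def WhiteRules (M : Set ((ℤ × ℤ) × (ℤ × ℤ))) (h : ℤ × ℤ → ℤ) (c : ℤ × ℤ) : Prop :=
  h (c + (0, 1)) = h (c + (1, 0)) + stepVal M c (c + (1, 1)) ∧
  h (c + (-1, 0)) = h (c + (0, 1)) + stepVal M c (c + (-1, 1)) ∧
  h (c + (0, -1)) = h (c + (-1, 0)) + stepVal M c (c + (-1, -1)) ∧
  h (c + (1, 0)) = h (c + (0, -1)) + stepVal M c (c + (1, -1))

/-- Thurston's rule clockwise around a black vertex `c`. -/
def BlackRules (M : Set ((ℤ × ℤ) × (ℤ × ℤ))) (h : ℤ × ℤ → ℤ) (c : ℤ × ℤ) : Prop :=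
  h (c + (0, -1)) = h (c + (1, 0)) + stepVal M c (c + (1, -1)) ∧
  h (c + (-1, 0)) = h (c + (0, -1)) + stepVal M c (c + (-1, -1)) ∧
  h (c + (0, 1)) = h (c + (-1, 0)) + stepVal M c (c + (-1, 1)) ∧
  h (c + (1, 0)) = h (c + (0, 1)) + stepVal M c (c + (1, 1))

/-- The height function of the Aztec diamond of size `n` with matching `M`:
boundary normalization `h(-n,-n) = -n` together with the local rules. -/
def IsAztecHeight (n : ℤ) (M : Set ((ℤ × ℤ) × (ℤ × ℤ))) (h : ℤ × ℤ → ℤ) : Prop :=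
  h (-n, -n) = -n ∧
  (∀ c, WhiteV c → inBox n c → WhiteRules M h c) ∧
  (∀ c, BlackV c → inBox n c → BlackRules M h c)

/-- The height of a vertex: the average of the heights of its four incident faces. -/
def vertexHeight (h : ℤ × ℤ → ℤ) (v : ℤ × ℤ) : ℚ :=
  ((h (v + (1, 0)) + h (v + (-1, 0)) + h (v + (0, 1)) + h (v + (0, -1)) : ℤ) : ℚ) / 4

/-- Counterclockwise rotation by 90°. -/
def rotCCW (d : ℤ × ℤ) : ℤ × ℤ := (-d.2, d.1)

/-- Clockwise rotation by 90°. -/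
def rotCW (d : ℤ × ℤ) : ℤ × ℤ := (d.2, -d.1)

lemma WhiteV.not_blackV {v : ℤ × ℤ} (hv : WhiteV v) : ¬ BlackV v :=
  fun hb => (Int.not_even_iff_odd.mpr hv.1) hb.1

lemma WhiteV.blackV_add {v e : ℤ × ℤ} (hv : WhiteV v) (he : e ∈ diagDirs) : BlackV (v + e) := by
  obtain ⟨⟨a, ha⟩, ⟨b, hb⟩⟩ := hv
  simp only [BlackV, Prod.fst_add, Prod.snd_add, Int.even_iff, Int.odd_iff]
  rcases he with rfl | rfl | rfl | rfl <;> constructor <;> dsimp only <;> omega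

section Matching

variable {n : ℤ} {M : Set ((ℤ × ℤ) × (ℤ × ℤ))}

lemma IsAztecMatching.blackV_snd (hM : IsAztecMatching n M) {v b : ℤ × ℤ} (hvb : (v, b) ∈ M) :
    BlackV b := by
  obtain ⟨hv, he, -, -⟩ := hM.1 _ hvb
  simpa using hv.blackV_add he

lemma IsAztecMatching.stepVal_white (hM : IsAztecMatching n M) {v b : ℤ × ℤ} (hvb : (v, b) ∈ M)
    (w : ℤ × ℤ) : stepVal M v w = if w = b then -3 else 1 := by
  obtain ⟨hv, -, hbox, -⟩ := hM.1 _ hvb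
  have hcov : covered M v w ↔ w = b := by
    constructor
    · rintro (hw | hw)
      · exact (hM.2.1 v hv hbox).unique hw hvb
      · exact absurd (hM.blackV_snd hw) hv.not_blackV
    · rintro rfl
      exact Or.inl hvb
  simp only [stepVal, hcov]

lemma IsAztecMatching.stepVal_black (hM : IsAztecMatching n M) {v b : ℤ × ℤ} (hvb : (v, b) ∈ M)
    (w : ℤ × ℤ) : stepVal M b w = if w = v then -3 else 1 := by
  obtain ⟨-, -, -, hbox⟩ := hM.1 _ hvb
  have hb := hM.blackV_snd hvb
  have hcov : covered M b w ↔ w = v := by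
    constructor
    · rintro (hw | hw)
      · exact absurd hb (hM.1 _ hw).1.not_blackV
      · exact (hM.2.2 b hb hbox).unique hw hvb
    · rintro rfl
      exact Or.inr hvb
  simp only [stepVal, hcov]

/-- The vertex height changes by `+1` across a left turn, `-1` across a right turn, and is
unchanged when the path goes straight. -/
lemma vertexHeight_sub_of_consecutive (hM : IsAztecMatching n M) {h : ℤ × ℤ → ℤ}
    (hh : IsAztecHeight n M h) {v e e' : ℤ × ℤ} (he : e ∈ diagDirs) (he' : e' ∈ diagDirs)
    (hv : (v, v + e) ∈ M) (hv' : (v + e + e, v + e + e + e') ∈ M) :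
    vertexHeight h (v + e + e) - vertexHeight h v
      = (if e' = rotCCW e then 1 else 0) - (if e' = rotCW e then 1 else 0) := by
  have hback : e' ≠ -e := by
    rintro rfl
    obtain ⟨-, -, -, hbox⟩ := hM.1 _ hv
    rw [add_neg_cancel_right] at hv'
    have h2 := (hM.2.2 _ (hM.blackV_snd hv) hbox).unique hv' hv
    have h3 : e + e = 0 := by simpa [add_assoc] using h2
    have h4 : e.1 + e.1 = 0 := congrArg Prod.fst h3
    rcases he with rfl | rfl | rfl | rfl <;> simp at h4
  obtain ⟨hw, -, hwbox, hbbox⟩ := hM.1 _ hv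
  obtain ⟨hw', -, hwbox', -⟩ := hM.1 _ hv'
  have r1 := hh.2.1 _ hw hwbox
  have r2 := hh.2.2 _ (hM.blackV_snd hv) hbbox
  have r3 := hh.2.1 _ hw' hwbox'
  simp only [WhiteRules, BlackRules, hM.stepVal_white hv, hM.stepVal_black hv,
    hM.stepVal_white hv'] at r1 r2 r3
  clear hv hv' hw hw' hwbox hwbox' hbbox hh hM
  have key : ∀ S T : ℤ, S - T = ((if e' = rotCCW e then 1 else 0)
      - (if e' = rotCW e then 1 else 0)) * 4 →
      (S : ℚ) / 4 - (T : ℚ) / 4 = (if e' = rotCCW e then 1 else 0)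
        - (if e' = rotCW e then 1 else 0) := by
    intro S T hST
    rw [← sub_div, div_eq_iff (by norm_num)]
    exact_mod_cast hST
  refine key _ _ ?_
  clear key
  obtain ⟨x, y⟩ := v
  rcases he with rfl | rfl | rfl | rfl <;> rcases he' with rfl | rfl | rfl | rfl <;>
    simp [rotCW, rotCCW, add_assoc] at r1 r2 r3 hback ⊢ <;> omega

end Matching

lemma rotCCW_add (d e : ℤ × ℤ) : rotCCW (d + e) = rotCCW d + rotCCW e := by
  ext <;> simp [rotCCW]; ring

lemma rotCW_add (d e : ℤ × ℤ) : rotCW (d + e) = rotCW d + rotCW e := by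
  ext <;> simp [rotCW]; ring

lemma add_self_inj_int_prod {d e : ℤ × ℤ} : d + d = e + e ↔ d = e := by
  simp only [Prod.ext_iff, Prod.fst_add, Prod.snd_add]
  omega

theorem stmt5 (n : ℤ) (hn : 0 < n)
    (M : Set ((ℤ × ℤ) × (ℤ × ℤ))) (hM : IsAztecMatching n M)
    (h : ℤ × ℤ → ℤ) (hh : IsAztecHeight n M h)
    (k : ℕ) (hk : 1 ≤ k) (s : ℕ → ℤ × ℤ)
    (hsouth : ∀ i ≤ k, SouthV (s i) ∧ inBox n (s i))
    (hpath : ∀ i < k, ∃ e ∈ diagDirs, (s i, s i + e) ∈ M ∧ s (i + 1) = s i + e + e) :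
    vertexHeight h (s (k - 1)) - vertexHeight h (s 0)
      = ((((Finset.Ico 1 k).filter
            (fun i => s (i + 1) - s i = rotCCW (s i - s (i - 1)))).card : ℚ)
        - (((Finset.Ico 1 k).filter
            (fun i => s (i + 1) - s i = rotCW (s i - s (i - 1)))).card : ℚ)) := by
  choose! e he heM hs using hpath
  have hstep : ∀ i < k, s (i + 1) - s i = e i + e i := fun i hi => by
    rw [hs i hi, add_assoc, add_sub_cancel_left]
  have hturn : ∀ i ∈ Finset.Ico 1 k, vertexHeight h (s i) - vertexHeight h (s (i - 1))
      = (if s (i + 1) - s i = rotCCW (s i - s (i - 1)) then 1 else 0)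
        - (if s (i + 1) - s i = rotCW (s i - s (i - 1)) then 1 else 0) := by
    intro i hi
    obtain ⟨h1, hik⟩ := Finset.mem_Ico.mp hi
    obtain ⟨j, rfl⟩ := Nat.exists_eq_add_of_le' h1
    have hj : j < k := by omega
    rw [Nat.add_sub_cancel, hstep _ hik, hstep _ hj, rotCCW_add, rotCW_add]
    simp only [add_self_inj_int_prod]
    have hnext := heM _ hik
    rw [hs j hj] at hnext ⊢
    exact vertexHeight_sub_of_consecutive hM hh (he _ hj) (he _ hik) (heM _ hj) hnext
  have htel : ∑ i ∈ Finset.Ico 1 k, (vertexHeight h (s i) - vertexHeight h (s (i - 1)))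
      = vertexHeight h (s (k - 1)) - vertexHeight h (s 0) := by
    rw [Finset.sum_Ico_eq_sum_range]
    simp only [add_comm 1]
    exact Finset.sum_range_sub (fun i => vertexHeight h (s i)) (k - 1)
  rw [← htel, Finset.sum_congr rfl hturn, Finset.sum_sub_distrib, Finset.sum_boole,
    Finset.sum_boole]

end
end

section
/- Let F be a dimer-compatible forest on the south-vertex graph of the Aztec diamond of size n (n divisible by 4). Label the boundary sources and sinks clockwise starting from the northeast corner as v_1^E, ..., v_{n/2+1}^E, v_{n/2}^S, ..., v_1^S, v_1^W, ..., v_{n/2}^W, v_{n/2}^N, ..., v_1^N. Then: (1) there exists a split index I in {0, ..., n/2} such that for j <= I the tree-path from v_j^S ends on the west boundary and for j > I it ends on the east boundary; (2) moreover theta_F(v_j^S) = v_j^E for j > I and theta_F(v_j^S) = v_j^W for j <= I, and theta_F(v_j^N) = v_{j+1}^E for j < I and theta_F(v_j^N) = v_j^W for j > I. -/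
/-!
STATEMENT 6: For a dimer-compatible forest `F` on the south-vertex graph of the Aztec
diamond of size `n` (with `4 ∣ n`), labelling the boundary sources and sinks clockwise
from the northeast corner, there exists a split index `I ∈ {0, …, n/2}` such that the
tree-path from `v_j^S` ends on the west boundary iff `j ≤ I`, and moreover
`θ_F(v_j^S) = v_j^E` for `j > I`, `θ_F(v_j^S) = v_j^W` for `j ≤ I`,
`θ_F(v_j^N) = v_{j+1}^E` for `j < I`, and `θ_F(v_j^N) = v_j^W` for `j > I`.
-/

/-- South-class vertices of the full plane: white vertices south of their `a`-face. -/
def Stilde (v : ℤ × ℤ) : Prop := Odd v.1 ∧ Even v.2 ∧ (4 : ℤ) ∣ (v.1 + v.2 - 1)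

/-- The steps of the south-vertex graph `G(S)`. -/
def bigDiag : Set (ℤ × ℤ) := {(2, 2), (2, -2), (-2, 2), (-2, -2)}

/-- One step along the oriented forest `F`, fixing vertices with no outgoing edge. -/
def nextF (F : ℤ × ℤ → Option (ℤ × ℤ)) (v : ℤ × ℤ) : ℤ × ℤ := (F v).getD v

/-- Sink vertices: the east/west boundary `∂ˣS` at `x = ±(n+1)`. -/
def IsSink (n : ℤ) (v : ℤ × ℤ) : Prop := |v.1| = n + 1

/-- The oriented path of `F` from `v` reaches the sink vertex `s`. -/
def ReachSink (n : ℤ) (F : ℤ × ℤ → Option (ℤ × ℤ)) (v s : ℤ × ℤ) : Prop :=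
  (∃ k : ℕ, (nextF F)^[k] v = s) ∧ IsSink n s

/-- A dimer-compatible forest on `G(S)`, oriented toward the sink boundary:
every interior south vertex has exactly one outgoing edge (a `(±2,±2)` step staying in
the enlarged box), every vertex reaches a sink, and every source vertex on the
north/south boundary reaches a sink inside its cross-shaped region. -/
def IsDCF (n : ℤ) (F : ℤ × ℤ → Option (ℤ × ℤ)) : Prop :=
  (∀ v, Stilde v → |v.1| ≤ n → |v.2| ≤ n →
      ∃ w, F v = some w ∧ (w - v) ∈ bigDiag ∧ |w.1| ≤ n + 1 ∧ |w.2| ≤ n) ∧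
  (∀ v, ¬(Stilde v ∧ |v.1| ≤ n ∧ |v.2| ≤ n) → F v = none) ∧
  (∀ v, Stilde v → |v.1| ≤ n → |v.2| ≤ n → ∃ s, ReachSink n F v s) ∧
  (∀ v, Stilde v → |v.1| ≤ n → |v.2| = n →
      ∀ s, ReachSink n F v s → ∃ k : ℤ, s - v = (2 * k, 2 * k) ∨ s - v = (2 * k, -(2 * k)))

/-- The `j`-th source on the south boundary (left to right). -/
def vS (n j : ℤ) : ℤ × ℤ := (4 * j - 3 - n, -n)

/-- The `j`-th sink on the east boundary (top to bottom, clockwise from the NE corner). -/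
def vE (n j : ℤ) : ℤ × ℤ := (n + 1, n - 4 * (j - 1))

/-- The `j`-th sink on the west boundary (bottom to top, clockwise). -/
def vW (n j : ℤ) : ℤ × ℤ := (-(n + 1), -n - 2 + 4 * j)

/-- The `j`-th source on the north boundary (right to left, clockwise). -/
def vN (n j : ℤ) : ℤ × ℤ := (n + 1 - 4 * j, n)

/-- South vertices of the box, including the sinks. -/
def InBox (n : ℤ) (v : ℤ × ℤ) : Prop := Stilde v ∧ |v.1| ≤ n + 1 ∧ |v.2| ≤ n

/-- `w` is `v` or a neighbour of `v` in the south-vertex graph. -/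
def IsStep (v w : ℤ × ℤ) : Prop :=
  (w.1 = v.1 ∧ w.2 = v.2) ∨ (w.1 = v.1 + 2 ∧ w.2 = v.2 + 2) ∨ (w.1 = v.1 + 2 ∧ w.2 = v.2 - 2) ∨
    (w.1 = v.1 - 2 ∧ w.2 = v.2 + 2) ∨ (w.1 = v.1 - 2 ∧ w.2 = v.2 - 2)

lemma InBox.coords {n : ℤ} {v : ℤ × ℤ} (h : InBox n v) :
    v.1 % 2 = 1 ∧ v.2 % 2 = 0 ∧ (v.1 + v.2) % 4 = 1 ∧
      -(n + 1) ≤ v.1 ∧ v.1 ≤ n + 1 ∧ -n ≤ v.2 ∧ v.2 ≤ n := by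
  obtain ⟨⟨h1, h2, h3⟩, h4, h5⟩ := h
  rw [abs_le] at h4 h5
  rw [Int.odd_iff] at h1
  rw [Int.even_iff] at h2
  omega

lemma IsSink.fst_eq {n : ℤ} (hn : 0 < n) {s : ℤ × ℤ} (h : IsSink n s) :
    s.1 = n + 1 ∨ s.1 = -(n + 1) :=
  (abs_eq (by omega)).1 h

section Forest

variable {n : ℤ} {F : ℤ × ℤ → Option (ℤ × ℤ)}

lemma nextF_of_isSink (hF : IsDCF n F) {s : ℤ × ℤ} (hs : IsSink n s) : nextF F s = s := by
  have h : F s = none := hF.2.1 s fun h => by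
    have h1 : |s.1| = n + 1 := hs
    have h2 := h.2.1
    omega
  simp [nextF, h]

lemma iterate_nextF_of_isSink (hF : IsDCF n F) {s : ℤ × ℤ} (hs : IsSink n s) (k : ℕ) :
    (nextF F)^[k] s = s :=
  Function.iterate_fixed (nextF_of_isSink hF hs) k

lemma inBox_nextF (hF : IsDCF n F) {v : ℤ × ℤ} (hv : InBox n v) :
    InBox n (nextF F v) ∧ IsStep v (nextF F v) := by
  by_cases h : |v.1| ≤ n
  · obtain ⟨w, hw, hd, h1, h2⟩ := hF.1 v hv.1 h hv.2.2
    have hnext : nextF F v = w := by simp [nextF, hw]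
    have hstep : IsStep v w := by
      simp only [bigDiag, Set.mem_insert_iff, Set.mem_singleton_iff, Prod.ext_iff, Prod.fst_sub,
        Prod.snd_sub] at hd
      unfold IsStep
      omega
    rw [hnext]
    refine ⟨⟨?_, h1, h2⟩, hstep⟩
    have hc := hv.coords
    refine ⟨Int.odd_iff.2 ?_, Int.even_iff.2 ?_, ?_⟩ <;> unfold IsStep at hstep <;> omega
  · have hs : IsSink n v := le_antisymm hv.2.1 (by omega)
    rw [nextF_of_isSink hF hs]
    exact ⟨hv, Or.inl ⟨rfl, rfl⟩⟩

lemma inBox_iterate (hF : IsDCF n F) {v : ℤ × ℤ} (hv : InBox n v) (k : ℕ) :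
    InBox n ((nextF F)^[k] v) := by
  induction k with
  | zero => exact hv
  | succ k ih => rw [Function.iterate_succ_apply']; exact (inBox_nextF hF ih).1

lemma isStep_iterate (hF : IsDCF n F) {v : ℤ × ℤ} (hv : InBox n v) (k : ℕ) :
    IsStep ((nextF F)^[k] v) ((nextF F)^[k + 1] v) := by
  rw [Function.iterate_succ_apply']
  exact (inBox_nextF hF (inBox_iterate hF hv k)).2

lemma ReachSink.iterate (hF : IsDCF n F) {v s : ℤ × ℤ} (h : ReachSink n F v s) (i : ℕ) :
    ReachSink n F ((nextF F)^[i] v) s := by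
  obtain ⟨⟨k, hk⟩, hs⟩ := h
  refine ⟨⟨k, ?_⟩, hs⟩
  rw [← Function.iterate_add_apply, add_comm, Function.iterate_add_apply, hk,
    iterate_nextF_of_isSink hF hs]

lemma ReachSink.unique (hF : IsDCF n F) {v s t : ℤ × ℤ} (hs : ReachSink n F v s)
    (ht : ReachSink n F v t) : s = t := by
  obtain ⟨⟨k, hk⟩, hs'⟩ := hs
  obtain ⟨⟨l, hl⟩, ht'⟩ := ht.iterate hF k
  rw [hk, iterate_nextF_of_isSink hF hs'] at hl
  exact hl

lemma ReachSink.inBox (hF : IsDCF n F) {v s : ℤ × ℤ} (hv : InBox n v) (h : ReachSink n F v s) :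
    InBox n s := by
  obtain ⟨⟨k, rfl⟩, -⟩ := h
  exact inBox_iterate hF hv k

lemma ReachSink.iterate_ne (hF : IsDCF n F) {a b s t : ℤ × ℤ} (ha : ReachSink n F a t)
    (hb : ReachSink n F b s) (hne : t ≠ s) (i j : ℕ) :
    (nextF F)^[i] a ≠ (nextF F)^[j] b := fun h =>
  hne ((h ▸ ha.iterate hF i).unique hF (hb.iterate hF j))

lemma ReachSink.iterate_ne_sink (hF : IsDCF n F) {a s t : ℤ × ℤ} (ha : ReachSink n F a t)
    (hs : IsSink n s) (hne : t ≠ s) (i : ℕ) : (nextF F)^[i] a ≠ s :=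
  ha.iterate_ne hF ⟨⟨0, rfl⟩, hs⟩ hne i 0

end Forest

/-- The edge `a b` passes above `z`, in the column of width two to the right of `z`. -/
def PassesAbove (a b z : ℤ × ℤ) : Prop :=
  ((a.1 = z.1 ∧ b.1 = z.1 + 2) ∨ (b.1 = z.1 ∧ a.1 = z.1 + 2)) ∧ 2 * z.2 < a.2 + b.2

open Classical in
/-- The indicator of a proposition modulo two. -/
noncomputable def ind (A : Prop) : ZMod 2 := if A then 1 else 0

lemma ind_pos {A : Prop} (h : A) : ind A = 1 := if_pos h

lemma ind_neg {A : Prop} (h : ¬A) : ind A = 0 := if_neg h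

/-- The parity of the number of edges among the first `m` edges of `p` which pass above `z`. -/
noncomputable def crossings (p : ℕ → ℤ × ℤ) (m : ℕ) (z : ℤ × ℤ) : ZMod 2 :=
  ∑ i ∈ Finset.range m, ind (PassesAbove (p i) (p (i + 1)) z)

lemma ind_add_ind_eq {A B C D : Prop} (h : Xor A B ↔ Xor C D) :
    ind A + ind B = ind C + ind D := by
  have h2 : (1 : ZMod 2) + 1 = 0 := rfl
  by_cases hA : A <;> by_cases hB : B <;> by_cases hC : C <;> by_cases hD : D <;>
    simp_all [ind, Xor]

lemma ind_eq_ind_add_ind {A C D : Prop} (h : A ↔ Xor C D) : ind A = ind C + ind D := by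
  have := ind_add_ind_eq (A := A) (B := False) (C := C) (D := D) (by simpa [Xor] using h)
  rwa [ind_neg not_false, add_zero] at this

lemma ind_add_self (A : Prop) : ind A + ind A = 0 := CharTwo.add_self_eq_zero _

lemma zmod_two_add_add_cancel (a b c : ZMod 2) : a + b + (b + c) = a + c := by
  revert a b c; decide

lemma crossings_eq_of_forall {p : ℕ → ℤ × ℤ} {m : ℕ} {z : ℤ × ℤ} (g : ℤ × ℤ → Prop)
    (h : ∀ i, PassesAbove (p i) (p (i + 1)) z ↔ Xor (g (p i)) (g (p (i + 1)))) :
    crossings p m z = ind (g (p 0)) + ind (g (p m)) := by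
  induction m with
  | zero => simp [crossings, ind_add_self]
  | succ m ih =>
    rw [crossings, Finset.sum_range_succ, ← crossings, ih, ind_eq_ind_add_ind (h m),
      zmod_two_add_add_cancel]

lemma crossings_eq_zero {p : ℕ → ℤ × ℤ} {m : ℕ} {z : ℤ × ℤ}
    (h : ∀ i, ¬PassesAbove (p i) (p (i + 1)) z) : crossings p m z = 0 :=
  Finset.sum_eq_zero fun i _ => ind_neg (h i)

lemma passesAbove_comm {a b z : ℤ × ℤ} : PassesAbove a b z ↔ PassesAbove b a z := by
  unfold PassesAbove
  omega

lemma passesAbove_right_step {n : ℤ} {a b z : ℤ × ℤ} (ha : InBox n a) (hz : InBox n z)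
    (h1 : b.1 = a.1 + 2) (h2 : b.2 = a.2 + 2 ∨ b.2 = a.2 - 2) (haz : a ≠ z) :
    PassesAbove a b z ↔ a.1 = z.1 ∧ z.2 < a.2 := by
  have ca := ha.coords
  have cz := hz.coords
  rw [ne_eq, Prod.ext_iff] at haz
  unfold PassesAbove
  omega

lemma ind_passesAbove_right_step {n : ℤ} {a b z w : ℤ × ℤ} (ha : InBox n a) (hb : InBox n b)
    (hz : InBox n z) (hw : InBox n w)
    (hab : b.1 = a.1 + 2) (hab' : b.2 = a.2 + 2 ∨ b.2 = a.2 - 2)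
    (hzw : w.1 = z.1 + 2) (hzw' : w.2 = z.2 + 2 ∨ w.2 = z.2 - 2)
    (haz : a ≠ z) (haw : a ≠ w) (hbw : b ≠ w) :
    ind (PassesAbove a b z) + ind (PassesAbove a b w) =
      ind (a.1 = w.1 ∧ w.2 < a.2) + ind (b.1 = w.1 ∧ w.2 < b.2) := by
  have h : (a.1 = z.1 ∧ z.2 < a.2) ↔ (b.1 = w.1 ∧ w.2 < b.2) := by
    have ca := ha.coords
    have cb := hb.coords
    have cz := hz.coords
    have cw := hw.coords
    rw [ne_eq, Prod.ext_iff] at haz hbw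
    clear haw
    omega
  rw [passesAbove_right_step ha hz hab hab' haz, passesAbove_right_step ha hw hab hab' haw, h,
    add_comm]

lemma ind_passesAbove_add {n : ℤ} {a b z w : ℤ × ℤ} (ha : InBox n a) (hb : InBox n b)
    (hz : InBox n z) (hw : InBox n w) (hab : IsStep a b)
    (hzw : w.1 = z.1 + 2) (hzw' : w.2 = z.2 + 2 ∨ w.2 = z.2 - 2)
    (haz : a ≠ z) (hbz : b ≠ z) (haw : a ≠ w) (hbw : b ≠ w) :
    ind (PassesAbove a b z) + ind (PassesAbove a b w) =
      ind (a.1 = w.1 ∧ w.2 < a.2) + ind (b.1 = w.1 ∧ w.2 < b.2) := by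
  have right := ind_passesAbove_right_step ha hb hz hw (hzw := hzw) (hzw' := hzw')
    (haz := haz) (haw := haw) (hbw := hbw)
  have left := ind_passesAbove_right_step hb ha hz hw (hzw := hzw) (hzw' := hzw')
    (haz := hbz) (haw := hbw) (hbw := haw)
  rw [passesAbove_comm (a := b), passesAbove_comm (a := b), add_comm (ind (b.1 = _ ∧ _))] at left
  rcases hab with h | h | h | h | h
  · rw [show b = a from Prod.ext h.1 h.2, ind_add_self, ind_neg, ind_neg, add_zero] <;>
      unfold PassesAbove <;> omega
  · exact right h.1 (.inl h.2)
  · exact right h.1 (.inr h.2)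
  · exact left (by omega) (by omega)
  · exact left (by omega) (by omega)

lemma crossings_add_crossings {n : ℤ} {p : ℕ → ℤ × ℤ} (hp : ∀ i, InBox n (p i))
    (hstep : ∀ i, IsStep (p i) (p (i + 1))) {z w : ℤ × ℤ} (hz : InBox n z) (hw : InBox n w)
    (h1 : w.1 = z.1 + 2) (h2 : w.2 = z.2 + 2 ∨ w.2 = z.2 - 2)
    (hpz : ∀ i, p i ≠ z) (hpw : ∀ i, p i ≠ w) (m : ℕ) :
    crossings p m z + crossings p m w =
      ind ((p 0).1 = w.1 ∧ w.2 < (p 0).2) + ind ((p m).1 = w.1 ∧ w.2 < (p m).2) := by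
  induction m with
  | zero => simp [crossings, ind_add_self]
  | succ m ih =>
    rw [crossings, crossings, Finset.sum_range_succ, Finset.sum_range_succ, ← crossings,
      ← crossings, add_add_add_comm, ih,
      ind_passesAbove_add (hp m) (hp (m + 1)) hz hw (hstep m) h1 h2 (hpz m) (hpz (m + 1)) (hpw m)
        (hpw (m + 1)),
      zmod_two_add_add_cancel]

/-- The side of the path `p` on which `z` lies; the extra term closes the path off to the east
when it ends in the column of `z` on the east boundary. -/
noncomputable def side (n : ℤ) (p : ℕ → ℤ × ℤ) (m : ℕ) (z : ℤ × ℤ) : ZMod 2 :=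
  crossings p m z + ind ((p m).1 = n + 1 ∧ z.1 = n + 1 ∧ z.2 < (p m).2)

section Side

variable {n : ℤ} {p : ℕ → ℤ × ℤ} {m : ℕ}

lemma side_eq_of_right_step (hn : 0 < n) (hp : ∀ i, InBox n (p i))
    (hstep : ∀ i, IsStep (p i) (p (i + 1))) (h0 : (p 0).2 = -n) (hm : IsSink n (p m))
    {z w : ℤ × ℤ} (hz : InBox n z) (hw : InBox n w)
    (h1 : w.1 = z.1 + 2) (h2 : w.2 = z.2 + 2 ∨ w.2 = z.2 - 2)
    (hpz : ∀ i, p i ≠ z) (hpw : ∀ i, p i ≠ w) : side n p m z = side n p m w := by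
  have h := crossings_add_crossings hp hstep hz hw h1 h2 hpz hpw m
  have c := hz.coords
  have d := hw.coords
  have hs := hm.fst_eq hn
  rw [ind_neg (by omega), zero_add] at h
  unfold side
  rw [ind_neg (A := (p m).1 = n + 1 ∧ z.1 = n + 1 ∧ z.2 < (p m).2) (by omega)]
  have hiff : ((p m).1 = n + 1 ∧ w.1 = n + 1 ∧ w.2 < (p m).2) ↔
      ((p m).1 = w.1 ∧ w.2 < (p m).2) := by omega
  simp only [hiff]
  rw [← h, add_zero]
  generalize crossings p m z = x
  generalize crossings p m w = y
  revert x y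
  decide

lemma side_eq_of_isStep (hn : 0 < n) (hp : ∀ i, InBox n (p i))
    (hstep : ∀ i, IsStep (p i) (p (i + 1))) (h0 : (p 0).2 = -n) (hm : IsSink n (p m))
    {z w : ℤ × ℤ} (hz : InBox n z) (hw : InBox n w) (hzw : IsStep z w)
    (hpz : ∀ i, p i ≠ z) (hpw : ∀ i, p i ≠ w) : side n p m z = side n p m w := by
  rcases hzw with h | h | h | h | h
  · rw [show w = z from Prod.ext h.1 h.2]
  · exact side_eq_of_right_step hn hp hstep h0 hm hz hw h.1 (.inl h.2) hpz hpw
  · exact side_eq_of_right_step hn hp hstep h0 hm hz hw h.1 (.inr h.2) hpz hpw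
  · exact (side_eq_of_right_step hn hp hstep h0 hm hw hz (by omega) (by omega) hpw hpz).symm
  · exact (side_eq_of_right_step hn hp hstep h0 hm hw hz (by omega) (by omega) hpw hpz).symm

lemma side_eq_zero_of_top (hp : ∀ i, InBox n (p i)) {z : ℤ × ℤ} (hz : z.2 = n) :
    side n p m z = 0 := by
  have hm := (hp m).coords
  rw [side, ind_neg (by omega), add_zero]
  refine crossings_eq_zero fun i h => ?_
  have a := (hp i).coords
  have b := (hp (i + 1)).coords
  have := h.2
  omega

lemma side_of_east (hp : ∀ i, InBox n (p i)) {z : ℤ × ℤ} (hz : z.1 = n + 1) :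
    side n p m z = ind ((p m).1 = n + 1 ∧ z.2 < (p m).2) := by
  rw [side, crossings_eq_zero, zero_add]
  · simp [hz]
  · intro i h
    have a := (hp i).coords
    have b := (hp (i + 1)).coords
    have := h.1
    omega

lemma side_of_west (hn : 0 < n) (hp : ∀ i, InBox n (p i))
    (hstep : ∀ i, IsStep (p i) (p (i + 1))) {z : ℤ × ℤ} (hzb : InBox n z) (hz : z.1 = -(n + 1))
    (hpz : ∀ i, p i ≠ z) :
    side n p m z = ind ((p 0).1 = -(n + 1) ∧ z.2 < (p 0).2) +
      ind ((p m).1 = -(n + 1) ∧ z.2 < (p m).2) := by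
  rw [side, ind_neg (by omega), add_zero]
  refine crossings_eq_of_forall (fun v => v.1 = -(n + 1) ∧ z.2 < v.2) fun i => ?_
  have a := (hp i).coords
  have b := (hp (i + 1)).coords
  have c := hzb.coords
  have e1 := hpz i
  have e2 := hpz (i + 1)
  have hs := hstep i
  simp only [ne_eq, Prod.ext_iff] at e1 e2
  unfold IsStep at hs
  unfold PassesAbove Xor
  omega

lemma side_of_bottom (hp : ∀ i, InBox n (p i)) (hstep : ∀ i, IsStep (p i) (p (i + 1)))
    {z : ℤ × ℤ} (hzb : InBox n z) (hz : z.2 = -n) (hz' : z.1 < n + 1) :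
    side n p m z = ind (z.1 < (p 0).1) + ind (z.1 < (p m).1) := by
  rw [side, ind_neg (by omega), add_zero]
  refine crossings_eq_of_forall (fun v => z.1 < v.1) fun i => ?_
  have a := (hp i).coords
  have b := (hp (i + 1)).coords
  have c := hzb.coords
  have hs := hstep i
  unfold IsStep at hs
  unfold PassesAbove Xor
  omega

end Side

section Sources

variable {n : ℤ} {F : ℤ × ℤ → Option (ℤ × ℤ)}

/-- Planarity: a path of the forest does not change sides of a path starting on the south
boundary and ending at another sink. -/
lemma side_eq_side_sink (hn : 0 < n) (hF : IsDCF n F) {a b s t : ℤ × ℤ} {m : ℕ}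
    (ha : InBox n a) (hb : InBox n b) (ha2 : a.2 = -n) (hm : (nextF F)^[m] a = t)
    (ht : IsSink n t) (hs : ReachSink n F b s) (hne : t ≠ s) :
    side n (fun i => (nextF F)^[i] a) m b = side n (fun i => (nextF F)^[i] a) m s := by
  have hdisj := ReachSink.iterate_ne hF ⟨⟨m, hm⟩, ht⟩ hs hne
  obtain ⟨⟨k, rfl⟩, -⟩ := hs
  have key : ∀ l, side n (fun i => (nextF F)^[i] a) m b =
      side n (fun i => (nextF F)^[i] a) m ((nextF F)^[l] b) := by
    intro l
    induction l with
    | zero => rfl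
    | succ l ih =>
      exact ih.trans (side_eq_of_isStep hn (inBox_iterate hF ha) (isStep_iterate hF ha) ha2
        (by simpa only [hm] using ht) (inBox_iterate hF hb l) (inBox_iterate hF hb (l + 1))
        (isStep_iterate hF hb l) (fun i => hdisj i l) (fun i => hdisj i (l + 1)))
  exact key k

lemma inBox_vS (hn4 : 4 ∣ n) {j : ℤ} (h1 : 1 ≤ j) (h2 : j ≤ n / 2) : InBox n (vS n j) := by
  simp only [InBox, Stilde, vS, Int.odd_iff, Int.even_iff, abs_le]
  omega

lemma inBox_vN (hn4 : 4 ∣ n) {j : ℤ} (h1 : 1 ≤ j) (h2 : j ≤ n / 2) : InBox n (vN n j) := by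
  simp only [InBox, Stilde, vN, Int.odd_iff, Int.even_iff, abs_le]
  omega

lemma reachSink_vS (hn : 0 < n) (hn4 : 4 ∣ n) (hF : IsDCF n F) {j : ℤ} (h1 : 1 ≤ j)
    (h2 : j ≤ n / 2) : ReachSink n F (vS n j) (vE n j) ∨ ReachSink n F (vS n j) (vW n j) := by
  have hv := inBox_vS hn4 h1 h2
  have hx : |(vS n j).1| ≤ n := by simp only [vS, abs_le]; omega
  obtain ⟨s, hs⟩ := hF.2.2.1 _ hv.1 hx hv.2.2
  obtain ⟨k, hk⟩ := hF.2.2.2 _ hv.1 hx (by simp [vS, hn.le]) s hs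
  have hb := (hs.inBox hF hv).coords
  simp only [Prod.ext_iff, vS, Prod.fst_sub, Prod.snd_sub] at hk
  rcases hs.2.fst_eq hn with h | h
  · left
    have : s = vE n j := Prod.ext h (by simp only [vE]; omega)
    exact this ▸ hs
  · right
    have : s = vW n j := Prod.ext h (by simp only [vW]; omega)
    exact this ▸ hs

lemma reachSink_vN (hn : 0 < n) (hn4 : 4 ∣ n) (hF : IsDCF n F) {j : ℤ} (h1 : 1 ≤ j)
    (h2 : j ≤ n / 2) :
    ReachSink n F (vN n j) (vE n (j + 1)) ∨ ReachSink n F (vN n j) (vW n j) := by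
  have hv := inBox_vN hn4 h1 h2
  have hx : |(vN n j).1| ≤ n := by simp only [vN, abs_le]; omega
  obtain ⟨s, hs⟩ := hF.2.2.1 _ hv.1 hx hv.2.2
  obtain ⟨k, hk⟩ := hF.2.2.2 _ hv.1 hx (by simp [vN, hn.le]) s hs
  have hb := (hs.inBox hF hv).coords
  simp only [Prod.ext_iff, vN, Prod.fst_sub, Prod.snd_sub] at hk
  rcases hs.2.fst_eq hn with h | h
  · left
    have : s = vE n (j + 1) := Prod.ext h (by simp only [vE]; omega)
    exact this ▸ hs
  · right
    have : s = vW n j := Prod.ext h (by simp only [vW]; omega)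
    exact this ▸ hs

lemma not_reachSink_vE_of_lt (hn : 0 < n) (hn4 : 4 ∣ n) (hF : IsDCF n F) {j k : ℤ} (h1 : 1 ≤ j)
    (hjk : j < k) (h2 : k ≤ n / 2) (hW : ReachSink n F (vS n k) (vW n k)) :
    ¬ReachSink n F (vS n j) (vE n j) := by
  rintro ⟨⟨m, hm⟩, ht⟩
  have ha := inBox_vS hn4 h1 (by omega : j ≤ n / 2)
  have hb := inBox_vS hn4 (by omega : 1 ≤ k) h2
  have hne : vE n j ≠ vW n k := fun h => by
    have := congrArg Prod.fst h
    simp only [vE, vW] at this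
    omega
  have h := side_eq_side_sink hn hF ha hb rfl hm ht hW hne
  rw [side_of_bottom (inBox_iterate hF ha) (isStep_iterate hF ha) hb rfl (by simp only [vS]; omega),
    side_of_west hn (inBox_iterate hF ha) (isStep_iterate hF ha) (hW.inBox hF hb) rfl
      (ReachSink.iterate_ne_sink hF ⟨⟨m, hm⟩, ht⟩ hW.2 hne)] at h
  simp only [hm, Function.iterate_zero, id_eq] at h
  simp only [vS, vE, vW] at h
  rw [ind_neg (by omega), ind_pos (by omega), ind_neg (by omega), ind_neg (by omega)] at h
  exact absurd h (by decide)

lemma not_reachSink_vN_vW (hn : 0 < n) (hn4 : 4 ∣ n) (hF : IsDCF n F) {j : ℤ} (h1 : 1 ≤ j)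
    (h2 : j + 1 ≤ n / 2) (hW : ReachSink n F (vS n (j + 1)) (vW n (j + 1))) :
    ¬ReachSink n F (vN n j) (vW n j) := by
  intro hs
  obtain ⟨⟨m, hm⟩, ht⟩ := hW
  have ha := inBox_vS hn4 (by omega : 1 ≤ j + 1) h2
  have hb := inBox_vN hn4 h1 (by omega : j ≤ n / 2)
  have hne : vW n (j + 1) ≠ vW n j := fun h => by
    have := congrArg Prod.snd h
    simp only [vW] at this
    omega
  have h := side_eq_side_sink hn hF ha hb rfl hm ht hs hne
  rw [side_eq_zero_of_top (inBox_iterate hF ha) rfl,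
    side_of_west hn (inBox_iterate hF ha) (isStep_iterate hF ha) (hs.inBox hF hb) rfl
      (ReachSink.iterate_ne_sink hF ⟨⟨m, hm⟩, ht⟩ hs.2 hne)] at h
  simp only [hm, Function.iterate_zero, id_eq] at h
  simp only [vS, vW] at h
  rw [ind_neg (by omega), ind_pos ⟨trivial, by omega⟩] at h
  exact absurd h (by decide)

lemma not_reachSink_vN_vE (hn : 0 < n) (hn4 : 4 ∣ n) (hF : IsDCF n F) {j : ℤ} (h1 : 1 ≤ j)
    (h2 : j ≤ n / 2) (hE : ReachSink n F (vS n j) (vE n j)) :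
    ¬ReachSink n F (vN n j) (vE n (j + 1)) := by
  intro hs
  obtain ⟨⟨m, hm⟩, ht⟩ := hE
  have ha := inBox_vS hn4 h1 h2
  have hne : vE n j ≠ vE n (j + 1) := fun h => by
    have := congrArg Prod.snd h
    simp only [vE] at this
    omega
  have h := side_eq_side_sink hn hF ha (inBox_vN hn4 h1 h2) rfl hm ht hs hne
  rw [side_eq_zero_of_top (inBox_iterate hF ha) rfl, side_of_east (inBox_iterate hF ha) rfl] at h
  simp only [hm] at h
  simp only [vE] at h
  rw [ind_pos ⟨trivial, by omega⟩] at h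
  exact absurd h (by decide)

/-- The indices of the sources on the south boundary whose paths end west form an initial
segment. -/
lemma exists_split_index (hn : 0 < n) (hn4 : 4 ∣ n) (hF : IsDCF n F) :
    ∃ I : ℤ, 0 ≤ I ∧ I ≤ n / 2 ∧ ∀ j : ℤ, 1 ≤ j → j ≤ n / 2 →
      (j ≤ I → ReachSink n F (vS n j) (vW n j)) ∧
      (I < j → ReachSink n F (vS n j) (vE n j)) := by
  obtain ⟨I, hI, hmax⟩ := Int.exists_greatest_of_bdd
    (P := fun i => i = 0 ∨ (1 ≤ i ∧ i ≤ n / 2 ∧ ReachSink n F (vS n i) (vW n i)))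
    ⟨n / 2, fun i hi => by omega⟩ ⟨0, Or.inl rfl⟩
  refine ⟨I, by omega, by omega, fun j h1 h2 => ⟨fun hj => ?_, fun hj => ?_⟩⟩
  · obtain hI | ⟨-, hI2, hW⟩ := hI
    · omega
    · rcases hj.eq_or_lt with rfl | hlt
      · exact hW
      · exact (reachSink_vS hn hn4 hF h1 h2).resolve_left
          (not_reachSink_vE_of_lt hn hn4 hF h1 hlt hI2 hW)
  · refine (reachSink_vS hn hn4 hF h1 h2).resolve_right fun hW => ?_
    have := hmax j (Or.inr ⟨h1, h2, hW⟩)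
    omega

end Sources

theorem stmt6 (n : ℤ) (hn : 0 < n) (hn4 : 4 ∣ n)
    (F : ℤ × ℤ → Option (ℤ × ℤ)) (hF : IsDCF n F) :
    ∃ I : ℤ, 0 ≤ I ∧ I ≤ n / 2 ∧
      (∀ j : ℤ, 1 ≤ j → j ≤ n / 2 →
        (j ≤ I → ∀ s, ReachSink n F (vS n j) s → s.1 = -(n + 1)) ∧
        (I < j → ∀ s, ReachSink n F (vS n j) s → s.1 = n + 1)) ∧
      (∀ j : ℤ, 1 ≤ j → j ≤ n / 2 →
        (j ≤ I → ReachSink n F (vS n j) (vW n j)) ∧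
        (I < j → ReachSink n F (vS n j) (vE n j))) ∧
      (∀ j : ℤ, 1 ≤ j → j ≤ n / 2 →
        (j < I → ReachSink n F (vN n j) (vE n (j + 1))) ∧
        (I < j → ReachSink n F (vN n j) (vW n j))) := by
  obtain ⟨I, h0, hI, hS⟩ := exists_split_index hn hn4 hF
  refine ⟨I, h0, hI, fun j h1 h2 => ⟨fun hj s hs => ?_, fun hj s hs => ?_⟩, hS,
    fun j h1 h2 => ⟨fun hj => ?_, fun hj => ?_⟩⟩
  · rw [hs.unique hF ((hS j h1 h2).1 hj), vW]
  · rw [hs.unique hF ((hS j h1 h2).2 hj), vE]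
  · exact (reachSink_vN hn hn4 hF h1 h2).resolve_right
      (not_reachSink_vN_vW hn hn4 hF h1 (by omega) ((hS (j + 1) (by omega) (by omega)).1 hj))
  · exact (reachSink_vN hn hn4 hF h1 h2).resolve_left
      (not_reachSink_vN_vE hn hn4 hF h1 h2 ((hS j h1 h2).2 hj))
end

section
/- Let F be a dimer-compatible forest on the south-vertex graph G(S) of the Aztec diamond of size n, and define its dual subgraph F-check of the north-vertex graph G(N) by including a dual edge if and only if it does not cross an edge of F (edges of G(N) are the rotations by pi/2 about midpoints of edges of G(S)). Then F-check is a spanning forest of G(N): it contains no cycles, and the number of its edges equals the number of north vertices, so it has exactly |boundary sinks of N| components. -/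
/-- North-class vertices. -/
def Ntilde (v : ℤ × ℤ) : Prop := Odd v.1 ∧ Even v.2 ∧ (4 : ℤ) ∣ (v.1 + v.2 + 1)

/-- Vertices of the north-vertex graph `G(N)` of the Aztec diamond (including sinks). -/
def NbarMem (n : ℤ) (v : ℤ × ℤ) : Prop := Ntilde v ∧ |v.1| ≤ n + 1 ∧ |v.2| ≤ n

/-- The dual forest `F̌` of `F`: the edges of `G(N)` (recorded left-to-right, so each
unordered edge appears exactly once) that do not cross an edge of `F`.  An `S`-edge and
an `N`-edge cross exactly when they have the same midpoint, i.e. the same endpoint sum. -/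
def dualForest (n : ℤ) (F : ℤ × ℤ → Option (ℤ × ℤ)) : Set ((ℤ × ℤ) × (ℤ × ℤ)) :=
  {e | NbarMem n e.1 ∧ NbarMem n e.2 ∧ (e.2 - e.1) ∈ ({(2, 2), (2, -2)} : Set (ℤ × ℤ)) ∧
    ¬∃ v w, F v = some w ∧ v + w = e.1 + e.2}

/-- Undirected adjacency in the dual forest. -/
def adjD (n : ℤ) (F : ℤ × ℤ → Option (ℤ × ℤ)) (u u' : ℤ × ℤ) : Prop :=
  (u, u') ∈ dualForest n F ∨ (u', u) ∈ dualForest n F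

lemma Stilde.of_sub_mem_bigDiag {v w : ℤ × ℤ} (hv : Stilde v) (h : w - v ∈ bigDiag) :
    Stilde w := by
  obtain ⟨x, y⟩ := v
  obtain ⟨x', y'⟩ := w
  simp only [bigDiag, Set.mem_insert_iff, Set.mem_singleton_iff, Prod.mk_sub_mk,
    Prod.mk.injEq] at h
  simp only [Stilde, Int.odd_iff, Int.even_iff] at *
  omega

lemma adjD.spec {n : ℤ} {F : ℤ × ℤ → Option (ℤ × ℤ)} {a b : ℤ × ℤ} (h : adjD n F a b) :
    NbarMem n a ∧ NbarMem n b ∧ (b.1 - a.1 = 2 ∨ b.1 - a.1 = -2) ∧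
      (b.2 - a.2 = 2 ∨ b.2 - a.2 = -2) ∧ ∀ v w, F v = some w → v + w ≠ a + b := by
  obtain ⟨x, y⟩ := a
  obtain ⟨x', y'⟩ := b
  simp only [adjD, dualForest, Set.mem_ofPred_eq, Set.mem_insert_iff, Set.mem_singleton_iff,
    Prod.mk_sub_mk, Prod.mk.injEq, not_exists, not_and] at h
  rcases h with ⟨h1, h2, h3, h4⟩ | ⟨h1, h2, h3, h4⟩
  · exact ⟨h1, h2, by simp only; omega, by simp only; omega, h4⟩
  · refine ⟨h2, h1, by simp only; omega, by simp only; omega, fun v w h => ?_⟩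
    rw [add_comm (x, y)]
    exact h4 v w h

/-- Sum of `e` along the horizontal ray to the right of `(x, y)` in steps of two. -/
def raySum (n : ℤ) (e : ℤ × ℤ → ZMod 2) (x y : ℤ) : ZMod 2 :=
  ∑ j ∈ Finset.range (n + 2).toNat, e (x + 2 * j, y)

/-- A mod-two chain on edge midpoints supported in the Aztec diamond with even degree at every
north vertex. -/
structure IsEvenChain (n : ℤ) (e : ℤ × ℤ → ZMod 2) : Prop where
  supp : ∀ x y, e (x, y) ≠ 0 → |x| ≤ n ∧ |y| ≤ n
  deg : ∀ x y, Ntilde (x, y) →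
    e (x + 1, y + 1) + e (x + 1, y - 1) + e (x - 1, y + 1) + e (x - 1, y - 1) = 0

namespace IsEvenChain

variable {n : ℤ} {e : ℤ × ℤ → ZMod 2}

lemma eq_zero (he : IsEvenChain n e) {x y : ℤ} (h : n < |x| ∨ n < |y|) : e (x, y) = 0 := by
  by_contra h0
  have := he.supp x y h0
  omega

lemma raySum_eq_zero (he : IsEvenChain n e) {x y : ℤ} (h : n < x ∨ n < |y|) :
    raySum n e x y = 0 := by
  refine Finset.sum_eq_zero fun j _ => he.eq_zero ?_
  rcases h with h | h
  · left
    have := le_abs_self (x + 2 * (j : ℤ))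
    omega
  · exact Or.inr h

lemma raySum_succ (he : IsEvenChain n e) (hn : 0 < n) {x y : ℤ} (hx : -n - 4 < x) :
    raySum n e x y = e (x, y) + raySum n e (x + 2) y := by
  have h0 : e (x + 2 * (((n + 2).toNat : ℕ) : ℤ), y) = 0 := by
    apply he.eq_zero
    left
    have := le_abs_self (x + 2 * (((n + 2).toNat : ℕ) : ℤ))
    omega
  have h1 := Finset.sum_range_succ (fun j : ℕ => e (x + 2 * (j : ℤ), y)) (n + 2).toNat
  rw [Finset.sum_range_succ', h0] at h1
  simp only [add_zero, Nat.cast_zero, mul_zero] at h1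
  rw [raySum, ← h1, raySum, add_comm]
  congr 1
  refine Finset.sum_congr rfl fun j _ => ?_
  congr 2
  push_cast
  ring

lemma raySum_above_eq_below (he : IsEvenChain n e) (hn : 0 < n) {x y : ℤ} (hv : Stilde (x, y))
    (hx : -n - 3 ≤ x) : raySum n e (x + 1) (y + 1) = raySum n e (x + 1) (y - 1) := by
  obtain ⟨k, hk⟩ : ∃ k : ℕ, n - x < 4 * (k : ℤ) := ⟨(n - x + 1).toNat, by omega⟩
  induction k generalizing x with
  | zero =>
    rw [he.raySum_eq_zero (Or.inl (by push_cast at hk; omega)),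
      he.raySum_eq_zero (Or.inl (by push_cast at hk; omega))]
  | succ k ih =>
    simp only [Stilde, Int.odd_iff, Int.even_iff] at hv ih
    have h1 := ih (x := x + 4) (by omega) (by omega) (by push_cast at hk; omega)
    have h2 := he.deg (x + 2) y (by simp only [Ntilde, Int.odd_iff, Int.even_iff]; omega)
    rw [he.raySum_succ hn (by omega), he.raySum_succ hn (x := x + 1 + 2) (by omega),
      he.raySum_succ hn (y := y - 1) (by omega),
      he.raySum_succ hn (x := x + 1 + 2) (y := y - 1) (by omega)]
    ring_nf at h1 h2 ⊢
    have h3 : (2 : ZMod 2) = 0 := rfl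
    linear_combination h1 + h2 - (e (1 + x, -1 + y) + e (3 + x, -1 + y)) * h3

lemma raySum_row_eq_zero (he : IsEvenChain n e) (hn : 0 < n) (hn4 : 4 ∣ n) {y : ℤ}
    (hy : Odd y) : raySum n e (-n) y = 0 := by
  obtain ⟨k, hk⟩ : ∃ k : ℕ, n - y < 2 * (k : ℤ) := ⟨(n - y + 1).toNat, by omega⟩
  induction k generalizing y with
  | zero =>
    refine he.raySum_eq_zero (Or.inr ?_)
    have := le_abs_self y
    push_cast at hk
    omega
  | succ k ih =>
    have h1 := ih (y := y + 2) (by rw [Int.odd_iff] at *; omega) (by push_cast at hk; omega)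
    rw [← h1]
    rw [Int.odd_iff] at hy
    have key : Stilde (-n - 1, y + 1) ∨ Stilde (-n - 3, y + 1) := by
      simp only [Stilde, Int.odd_iff, Int.even_iff]
      omega
    rcases key with h | h
    · have h2 := he.raySum_above_eq_below hn h (by omega)
      ring_nf at h2 ⊢
      exact h2.symm
    · have h2 := he.raySum_above_eq_below hn h (by omega)
      rw [he.raySum_succ hn (by omega), he.raySum_succ hn (y := y + 1 - 1) (by omega),
        he.eq_zero (Or.inl (by rw [abs_of_neg (by omega)]; omega)),
        he.eq_zero (y := y + 1 - 1) (Or.inl (by rw [abs_of_neg (by omega)]; omega))] at h2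
      ring_nf at h2 ⊢
      exact h2.symm

/-- The potential of an even chain changes across exactly the edges of the chain. -/
lemma raySum_eq_of_bigDiag (he : IsEvenChain n e) (hn : 0 < n) {x y x' y' : ℤ}
    (hv : Stilde (x, y)) (hw : Stilde (x', y')) (hx : -n - 1 ≤ x) (hx' : -n - 1 ≤ x')
    (h : (x', y') - (x, y) ∈ bigDiag) {a b : ℤ} (ha : x + x' = 2 * a) (hb : y + y' = 2 * b) :
    raySum n e (x + 1) (y + 1) = e (a, b) + raySum n e (x' + 1) (y' + 1) := by
  have hxy := he.raySum_above_eq_below hn hv (by omega)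
  have hxy' := he.raySum_above_eq_below hn hw (by omega)
  have h3 : (2 : ZMod 2) = 0 := rfl
  simp only [bigDiag, Set.mem_insert_iff, Set.mem_singleton_iff, Prod.mk_sub_mk,
    Prod.mk.injEq] at h
  rcases h with ⟨h1, h2⟩ | ⟨h1, h2⟩ | ⟨h1, h2⟩ | ⟨h1, h2⟩
  · obtain ⟨rfl, rfl, rfl, rfl⟩ : x' = x + 2 ∧ y' = y + 2 ∧ a = x + 1 ∧ b = y + 1 := by omega
    have := he.raySum_succ hn (x := x + 1) (y := y + 1) (by omega)
    ring_nf at *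
    linear_combination this - hxy'
  · obtain ⟨rfl, rfl, rfl, rfl⟩ : x' = x + 2 ∧ y' = y - 2 ∧ a = x + 1 ∧ b = y - 1 := by omega
    have := he.raySum_succ hn (x := x + 1) (y := y - 1) (by omega)
    ring_nf at *
    linear_combination hxy + this
  · obtain ⟨rfl, rfl, rfl, rfl⟩ : x = x' + 2 ∧ y' = y + 2 ∧ a = x' + 1 ∧ b = y + 1 := by omega
    have := he.raySum_succ hn (x := x' + 1) (y := y + 1) (by omega)
    ring_nf at *
    linear_combination - this - hxy' - e (1 + x', 1 + y) * h3
  · obtain ⟨rfl, rfl, rfl, rfl⟩ : x = x' + 2 ∧ y = y' + 2 ∧ a = x' + 1 ∧ b = y' + 1 := by omega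
    have := he.raySum_succ hn (x := x' + 1) (y := y' + 1) (by omega)
    ring_nf at *
    linear_combination - this + hxy - e (1 + x', 1 + y') * h3

lemma raySum_sink_eq_zero (he : IsEvenChain n e) (hn : 0 < n) (hn4 : 4 ∣ n) {x y : ℤ}
    (hv : Stilde (x, y)) (hs : |x| = n + 1) : raySum n e (x + 1) (y + 1) = 0 := by
  rcases (abs_eq (by omega)).1 hs with rfl | rfl
  · exact he.raySum_eq_zero (Or.inl (by omega))
  · have := he.raySum_row_eq_zero hn hn4 (Even.add_one hv.2.1)
    ring_nf at *
    exact this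

variable {F : ℤ × ℤ → Option (ℤ × ℤ)}

lemma raySum_eq_zero_of_iterate (he : IsEvenChain n e) (hn : 0 < n) (hn4 : 4 ∣ n)
    (hF : IsDCF n F)
    (hcross : ∀ v w, F v = some w → ∀ a b, v + w = (2 * a, 2 * b) → e (a, b) = 0)
    (k : ℕ) (v : ℤ × ℤ) (hv : Stilde v) (hx : |v.1| ≤ n + 1) (hs : IsSink n ((nextF F)^[k] v)) :
    raySum n e (v.1 + 1) (v.2 + 1) = 0 := by
  induction k generalizing v with
  | zero => exact he.raySum_sink_eq_zero hn hn4 hv hs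
  | succ k ih =>
    rw [Function.iterate_succ_apply] at hs
    by_cases hin : |v.1| ≤ n ∧ |v.2| ≤ n
    · obtain ⟨w, hw, hvw, hw1, -⟩ := hF.1 v hv hin.1 hin.2
      have hSw := hv.of_sub_mem_bigDiag hvw
      have hnext : nextF F v = w := by simp [nextF, hw]
      rw [hnext] at hs
      have hmid : ∃ a b, v.1 + w.1 = 2 * a ∧ v.2 + w.2 = 2 * b := by
        simp only [Stilde, Int.odd_iff, Int.even_iff] at hv hSw
        exact ⟨(v.1 + w.1) / 2, (v.2 + w.2) / 2, by omega, by omega⟩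
      obtain ⟨a, b, ha, hb⟩ := hmid
      rw [he.raySum_eq_of_bigDiag hn (x' := w.1) (y' := w.2) hv hSw
        (by have := (abs_le.1 hx).1; omega) (by have := (abs_le.1 hw1).1; omega) hvw ha hb,
        hcross v w hw a b (Prod.ext ha hb), ih w hSw hw1 hs, add_zero]
    · have hnone := hF.2.1 v fun h => hin h.2
      have hnext : nextF F v = v := by simp [nextF, hnone]
      rw [hnext] at hs
      exact ih v hv hx hs

/-- An even chain avoiding a dimer-compatible forest vanishes. -/
lemma eq_zero_of_forest (he : IsEvenChain n e) (hn : 0 < n) (hn4 : 4 ∣ n) (hF : IsDCF n F)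
    (hcross : ∀ v w, F v = some w → ∀ a b, v + w = (2 * a, 2 * b) → e (a, b) = 0)
    {a b : ℤ} (ha : Even a) (hb : Odd b) : e (a, b) = 0 := by
  by_cases hin : |a| ≤ n ∧ |b| ≤ n
  swap
  · exact he.eq_zero (by omega)
  have hpot : ∀ x y, Stilde (x, y) → |x| ≤ n + 1 → |y| ≤ n →
      raySum n e (x + 1) (y + 1) = 0 := by
    intro x y hv hx hy
    by_cases hxn : |x| ≤ n
    · obtain ⟨s, ⟨k, hk⟩, hs⟩ := hF.2.2.1 (x, y) hv hxn hy
      exact he.raySum_eq_zero_of_iterate hn hn4 hF hcross k (x, y) hv hx (hk ▸ hs)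
    · exact he.raySum_sink_eq_zero hn hn4 hv (by omega)
  rw [Int.even_iff] at ha
  rw [Int.odd_iff] at hb
  obtain ⟨ha1, ha2⟩ := abs_le.1 hin.1
  obtain ⟨hb1, hb2⟩ := abs_le.1 hin.2
  have key : (Stilde (a - 1, b - 1) ∧ Stilde (a + 1, b + 1)) ∨
      (Stilde (a - 1, b + 1) ∧ Stilde (a + 1, b - 1)) := by
    simp only [Stilde, Int.odd_iff, Int.even_iff]
    omega
  rcases key with ⟨h1, h2⟩ | ⟨h1, h2⟩
  all_goals
    have h := he.raySum_eq_of_bigDiag hn h1 h2 (by omega) (by omega)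
      (by
        simp only [bigDiag, Set.mem_insert_iff, Set.mem_singleton_iff, Prod.mk_sub_mk,
          Prod.mk.injEq]
        omega) (a := a) (b := b) (by ring) (by ring)
    rw [hpot _ _ h1 (abs_le.2 (by omega)) (abs_le.2 (by omega)),
      hpot _ _ h2 (abs_le.2 (by omega)) (abs_le.2 (by omega)), add_zero] at h
    exact h.symm

end IsEvenChain

/-- The number of passes, mod two, of the first `k` steps of `s` through the edge with midpoint
`m`. -/
def walkChain (s : ℕ → ℤ × ℤ) (k : ℕ) (m : ℤ × ℤ) : ZMod 2 :=
  ∑ i ∈ Finset.range k, if s i + s (i + 1) = (2 * m.1, 2 * m.2) then 1 else 0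

lemma exists_of_walkChain_ne_zero {s : ℕ → ℤ × ℤ} {k : ℕ} {m : ℤ × ℤ}
    (h : walkChain s k m ≠ 0) : ∃ i < k, s i + s (i + 1) = (2 * m.1, 2 * m.2) := by
  obtain ⟨i, hi, h⟩ := Finset.exists_ne_zero_of_sum_ne_zero h
  exact ⟨i, Finset.mem_range.1 hi, by by_contra h'; simp [h'] at h⟩

lemma step_degree {x y a b a' b' : ℤ} (hv : Ntilde (x, y)) (hu : Ntilde (a, b))
    (h1 : a' - a = 2 ∨ a' - a = -2) (h2 : b' - b = 2 ∨ b' - b = -2) :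
    ((if (a, b) + (a', b') = (2 * (x + 1), 2 * (y + 1)) then 1 else 0) +
      (if (a, b) + (a', b') = (2 * (x + 1), 2 * (y - 1)) then 1 else 0) +
      (if (a, b) + (a', b') = (2 * (x - 1), 2 * (y + 1)) then 1 else 0) +
      (if (a, b) + (a', b') = (2 * (x - 1), 2 * (y - 1)) then 1 else 0) : ZMod 2) =
    (if (a, b) = (x, y) then 1 else 0) + (if (a', b') = (x, y) then 1 else 0) := by
  simp only [Ntilde, Int.odd_iff, Int.even_iff] at hv hu
  simp only [Prod.mk_add_mk, Prod.mk.injEq]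
  by_cases hav : a = x ∧ b = y
  · obtain ⟨rfl, rfl⟩ := hav
    rcases h1 with h1 | h1 <;> rcases h2 with h2 | h2 <;>
      (obtain rfl := eq_add_of_sub_eq h1; obtain rfl := eq_add_of_sub_eq h2
       split_ifs <;> first | omega | rfl)
  · by_cases hbv : a' = x ∧ b' = y
    · obtain ⟨rfl, rfl⟩ := hbv
      rcases h1 with h1 | h1 <;> rcases h2 with h2 | h2 <;>
        (split_ifs <;> first | omega | rfl)
    · rw [if_neg (by omega), if_neg (by omega), if_neg (by omega), if_neg (by omega),
        if_neg hav, if_neg hbv]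
      rfl

lemma isEvenChain_walkChain {n : ℤ} {F : ℤ × ℤ → Option (ℤ × ℤ)} {s : ℕ → ℤ × ℤ} {k : ℕ}
    (hclosed : s k = s 0) (hadj : ∀ i < k, adjD n F (s i) (s (i + 1))) :
    IsEvenChain n (walkChain s k) where
  supp x y h := by
    obtain ⟨i, hi, h⟩ := exists_of_walkChain_ne_zero h
    obtain ⟨ha, hb, h1, h2, -⟩ := (hadj i hi).spec
    have e1 := congrArg Prod.fst h
    have e2 := congrArg Prod.snd h
    simp only [Prod.fst_add, Prod.snd_add] at e1 e2
    obtain ⟨-, ha1, ha2⟩ := ha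
    obtain ⟨-, hb1, hb2⟩ := hb
    rw [abs_le] at *
    rw [abs_le]
    omega
  deg x y hv := by
    have hstep : ∀ i ∈ Finset.range k, _ := fun i hi =>
      have h := (hadj i (Finset.mem_range.1 hi)).spec
      step_degree hv h.1.1 h.2.2.1 h.2.2.2.1
    have hsum := Finset.sum_congr rfl hstep
    simp only [Prod.mk.eta, Finset.sum_add_distrib] at hsum
    simp only [walkChain]
    rw [hsum]
    have h1 := Finset.sum_range_succ (fun i => if s i = (x, y) then (1 : ZMod 2) else 0) k
    rw [Finset.sum_range_succ', hclosed] at h1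
    rw [add_right_cancel h1]
    exact CharTwo.add_self_eq_zero _

lemma not_cycle_adjD {n : ℤ} (hn : 0 < n) (hn4 : 4 ∣ n) {F : ℤ × ℤ → Option (ℤ × ℤ)}
    (hF : IsDCF n F) {k : ℕ} (hk : 3 ≤ k) {s : ℕ → ℤ × ℤ} (hclosed : s k = s 0)
    (hinj : ∀ i j, i < k → j < k → s i = s j → i = j) :
    ¬ ∀ i < k, adjD n F (s i) (s (i + 1)) := by
  intro hadj
  obtain ⟨ha, hb, h1, h2, -⟩ := (hadj 0 (by omega)).spec
  obtain ⟨⟨hao, hae, ha4⟩, -⟩ := ha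
  rw [Int.odd_iff] at hao
  rw [Int.even_iff] at hae
  rw [zero_add] at *
  obtain ⟨a, hA⟩ : ∃ a, (s 0).1 + (s 1).1 = 2 * a := ⟨((s 0).1 + (s 1).1) / 2, by omega⟩
  obtain ⟨b, hB⟩ : ∃ b, (s 0).2 + (s 1).2 = 2 * b := ⟨((s 0).2 + (s 1).2) / 2, by omega⟩
  have hzero : walkChain s k (a, b) = 0 := by
    refine (isEvenChain_walkChain hclosed hadj).eq_zero_of_forest hn hn4 hF ?_
      (Int.even_iff.2 (by omega)) (Int.odd_iff.2 (by omega))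
    intro v w hvw x y hxy
    by_contra h0
    obtain ⟨i, hi, h⟩ := exists_of_walkChain_ne_zero h0
    exact (hadj i hi).spec.2.2.2.2 v w hvw (hxy.trans h.symm)
  have hone : walkChain s k (a, b) = 1 := by
    rw [walkChain, Finset.sum_eq_single 0]
    · exact if_pos (Prod.ext hA hB)
    · intro i hi hi0
      rw [Finset.mem_range] at hi
      refine if_neg fun h => ?_
      have e1 := congrArg Prod.fst h
      have e2 := congrArg Prod.snd h
      simp only [Prod.fst_add, Prod.snd_add] at e1 e2
      obtain ⟨⟨⟨ho, hee, hd⟩, -⟩, -, h1', h2', -⟩ := (hadj i hi).spec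
      rw [Int.odd_iff] at ho
      rw [Int.even_iff] at hee
      have hcase : ((s i).1 = (s 0).1 ∧ (s i).2 = (s 0).2) ∨
          (((s i).1 = (s 1).1 ∧ (s i).2 = (s 1).2) ∧
            (s (i + 1)).1 = (s 0).1 ∧ (s (i + 1)).2 = (s 0).2) := by omega
      rcases hcase with h | ⟨h, h'⟩
      · exact hi0 (hinj i 0 hi (by omega) (Prod.ext h.1 h.2))
      · obtain rfl := hinj i 1 hi (by omega) (Prod.ext h.1 h.2)
        have := hinj 2 0 (by omega) (by omega) (Prod.ext h'.1 h'.2)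
        omega
    · intro h
      exact absurd (Finset.mem_range.2 (by omega)) h
  rw [hone] at hzero
  exact one_ne_zero hzero

lemma IsDCF.some_spec {n : ℤ} {F : ℤ × ℤ → Option (ℤ × ℤ)} (hF : IsDCF n F) {v w : ℤ × ℤ}
    (h : F v = some w) : (Stilde v ∧ |v.1| ≤ n ∧ |v.2| ≤ n) ∧
      w - v ∈ bigDiag ∧ |w.1| ≤ n + 1 ∧ |w.2| ≤ n := by
  have hv : Stilde v ∧ |v.1| ≤ n ∧ |v.2| ≤ n := by
    by_contra hv
    simp [hF.2.1 v hv] at h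
  obtain ⟨w', hw', hw⟩ := hF.1 v hv.1 hv.2.1 hv.2.2
  obtain rfl := Option.some.inj (h.symm.trans hw')
  exact ⟨hv, hw⟩

/-- A dimer-compatible forest has no pair of opposite edges. -/
lemma IsDCF.not_two_cycle {n : ℤ} {F : ℤ × ℤ → Option (ℤ × ℤ)} (hF : IsDCF n F) {v w : ℤ × ℤ}
    (hvw : F v = some w) : F w ≠ some v := by
  intro hwv
  obtain ⟨hv, -⟩ := hF.some_spec hvw
  obtain ⟨hw, -⟩ := hF.some_spec hwv
  obtain ⟨s, ⟨k, hk⟩, hs⟩ := hF.2.2.1 v hv.1 hv.2.1 hv.2.2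
  have hiter : ∀ k : ℕ, (nextF F)^[k] v = v ∨ (nextF F)^[k] v = w := by
    intro k
    induction k with
    | zero => exact Or.inl rfl
    | succ k ih =>
      rw [Function.iterate_succ_apply']
      rcases ih with h | h
      · right; simp [h, nextF, hvw]
      · left; simp [h, nextF, hwv]
  rw [IsSink, ← hk] at hs
  rcases hiter k with h | h <;> rw [h] at hs <;> omega

lemma IsDCF.injOn_sum {n : ℤ} {F : ℤ × ℤ → Option (ℤ × ℤ)} (hF : IsDCF n F) {v w v' w' : ℤ × ℤ}
    (h : F v = some w) (h' : F v' = some w') (hsum : v + w = v' + w') : v = v' := by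
  obtain ⟨⟨hv, -⟩, hd, -⟩ := hF.some_spec h
  obtain ⟨⟨hv', -⟩, hd', -⟩ := hF.some_spec h'
  by_contra hne
  have hsw : v' = w ∧ w' = v := by
    obtain ⟨x, y⟩ := v
    obtain ⟨a, b⟩ := w
    obtain ⟨x', y'⟩ := v'
    obtain ⟨a', b'⟩ := w'
    simp only [bigDiag, Set.mem_insert_iff, Set.mem_singleton_iff, Prod.mk_sub_mk,
      Prod.mk_add_mk, Prod.mk.injEq, Stilde, Int.odd_iff, Int.even_iff] at *
    omega
  obtain ⟨rfl, rfl⟩ := hsw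
  exact hF.not_two_cycle h h'

lemma finite_box (a b : ℤ) : {v : ℤ × ℤ | |v.1| ≤ a ∧ |v.2| ≤ b}.Finite := by
  refine ((Set.finite_Icc (-a) a).prod (Set.finite_Icc (-b) b)).subset ?_
  rintro v ⟨h1, h2⟩
  exact ⟨abs_le.1 h1, abs_le.1 h2⟩

lemma ncard_north_eq_ncard_south (n : ℤ) :
    {v | Ntilde v ∧ |v.1| ≤ n ∧ |v.2| ≤ n}.ncard =
      {v | Stilde v ∧ |v.1| ≤ n ∧ |v.2| ≤ n}.ncard := by
  have hinj : Function.Injective (fun v : ℤ × ℤ => (-v.1, v.2)) := by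
    rintro ⟨x, y⟩ ⟨x', y'⟩ h
    simpa using h
  rw [← Set.ncard_image_of_injective _ hinj]
  congr 1
  ext ⟨x, y⟩
  simp only [Set.mem_image, Set.mem_ofPred_eq, Prod.exists, Prod.mk.injEq, Ntilde, Stilde,
    Int.odd_iff, Int.even_iff]
  constructor
  · rintro ⟨a, b, h, rfl, rfl⟩
    rw [abs_neg]
    omega
  · intro h
    exact ⟨-x, y, by rw [abs_neg]; omega, by ring, rfl⟩

/-- The doubled midpoints of all edges of the north-vertex graph. -/
def edgeSums (n : ℤ) : Set (ℤ × ℤ) :=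
  {p | (∃ a b, p = (2 * a, 2 * b) ∧ Even a ∧ Odd b) ∧ |p.1| ≤ 2 * n ∧ |p.2| ≤ 2 * n}

lemma ncard_edgeSums (n : ℤ) : (edgeSums n).ncard =
    {v | Ntilde v ∧ |v.1| ≤ n ∧ |v.2| ≤ n}.ncard +
      {v | Stilde v ∧ |v.1| ≤ n ∧ |v.2| ≤ n}.ncard := by
  have hinj : Function.Injective (fun v : ℤ × ℤ => (2 * v.2, 2 * v.1)) := by
    rintro ⟨x, y⟩ ⟨x', y'⟩ h
    simp only [Prod.mk.injEq] at h ⊢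
    omega
  rw [← Set.ncard_union_eq _ ((finite_box n n).subset fun v h => h.2)
    ((finite_box n n).subset fun v h => h.2), ← Set.ncard_image_of_injective (_ ∪ _) hinj]
  · congr 1
    ext ⟨x, y⟩
    simp only [edgeSums, Set.mem_image, Set.mem_union, Set.mem_ofPred_eq, Prod.exists,
      Prod.mk.injEq, Ntilde, Stilde, Int.odd_iff, Int.even_iff, abs_le]
    constructor
    · rintro ⟨⟨a, b, h, ha, hb⟩, h1, h2⟩
      exact ⟨b, a, by omega⟩
    · rintro ⟨b, a, h, rfl, rfl⟩
      exact ⟨⟨a, b, by omega⟩, by omega⟩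
  · rw [Set.disjoint_left]
    rintro ⟨x, y⟩ h h'
    simp only [Set.mem_ofPred_eq, Ntilde, Stilde, Int.odd_iff, Int.even_iff] at h h'
    omega

lemma IsDCF.ncard_sums {n : ℤ} {F : ℤ × ℤ → Option (ℤ × ℤ)} (hF : IsDCF n F) :
    {p | ∃ v w, F v = some w ∧ v + w = p}.ncard =
      {v | Stilde v ∧ |v.1| ≤ n ∧ |v.2| ≤ n}.ncard := by
  symm
  refine Set.ncard_congr (fun v _ => v + nextF F v) ?_ ?_ ?_
  · rintro v ⟨h1, h2, h3⟩
    obtain ⟨w, hw, -⟩ := hF.1 v h1 h2 h3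
    exact ⟨v, w, hw, by simp [nextF, hw]⟩
  · rintro v v' ⟨h1, h2, h3⟩ ⟨h1', h2', h3'⟩ h
    obtain ⟨w, hw, -⟩ := hF.1 v h1 h2 h3
    obtain ⟨w', hw', -⟩ := hF.1 v' h1' h2' h3'
    simp only [nextF, hw, hw', Option.getD_some] at h
    exact hF.injOn_sum hw hw' h
  · rintro p ⟨v, w, hw, rfl⟩
    exact ⟨v, (hF.some_spec hw).1, by simp [nextF, hw]⟩

lemma IsDCF.sums_subset_edgeSums {n : ℤ} {F : ℤ × ℤ → Option (ℤ × ℤ)} (hF : IsDCF n F) :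
    {p | ∃ v w, F v = some w ∧ v + w = p} ⊆ edgeSums n := by
  rintro p ⟨⟨x, y⟩, ⟨x', y'⟩, hw, rfl⟩
  obtain ⟨⟨hv, h1, h2⟩, hd, h3, h4⟩ := hF.some_spec hw
  simp only [bigDiag, Set.mem_insert_iff, Set.mem_singleton_iff, Prod.mk_sub_mk,
    Prod.mk.injEq, Stilde, Int.odd_iff, Int.even_iff, abs_le] at *
  simp only [edgeSums, Set.mem_ofPred_eq, Prod.mk_add_mk, Prod.mk.injEq, Int.odd_iff,
    Int.even_iff, abs_le]
  exact ⟨⟨(x + x') / 2, (y + y') / 2, by omega⟩, by omega⟩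

lemma image_sum_dualForest {n : ℤ} (hn4 : 4 ∣ n) (F : ℤ × ℤ → Option (ℤ × ℤ)) :
    (fun e : (ℤ × ℤ) × (ℤ × ℤ) => e.1 + e.2) '' dualForest n F =
      edgeSums n \ {p | ∃ v w, F v = some w ∧ v + w = p} := by
  apply Set.Subset.antisymm
  · rintro p ⟨⟨⟨x, y⟩, ⟨x', y'⟩⟩, ⟨h1, h2, h3, h4⟩, rfl⟩
    refine ⟨?_, h4⟩
    simp only [NbarMem, Ntilde, Set.mem_insert_iff, Set.mem_singleton_iff, Prod.mk_sub_mk,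
      Prod.mk.injEq, Int.odd_iff, Int.even_iff, abs_le] at h1 h2 h3
    simp only [edgeSums, Set.mem_ofPred_eq, Prod.mk_add_mk, Prod.mk.injEq, Int.odd_iff,
      Int.even_iff, abs_le]
    exact ⟨⟨(x + x') / 2, (y + y') / 2, by omega⟩, by omega⟩
  · rintro p ⟨⟨⟨a, b, rfl, ha, hb⟩, h1, h2⟩, h4⟩
    rw [Int.even_iff] at ha
    rw [Int.odd_iff] at hb
    simp only [abs_le] at h1 h2
    have key : (4 : ℤ) ∣ a + b - 1 ∨ (4 : ℤ) ∣ a + b + 1 := by omega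
    rcases key with h | h
    · have hsum : ((a - 1, b - 1) : ℤ × ℤ) + (a + 1, b + 1) = (2 * a, 2 * b) := by
        ext <;> simp only [Prod.fst_add, Prod.snd_add] <;> ring
      refine ⟨((a - 1, b - 1), (a + 1, b + 1)), ⟨?_, ?_, ?_, ?_⟩, hsum⟩
      · simp only [NbarMem, Ntilde, Int.odd_iff, Int.even_iff, abs_le]
        omega
      · simp only [NbarMem, Ntilde, Int.odd_iff, Int.even_iff, abs_le]
        omega
      · left
        ext <;> simp only [Prod.fst_sub, Prod.snd_sub] <;> ring
      · rintro ⟨v, w, hw, hvw⟩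
        exact h4 ⟨v, w, hw, hvw.trans hsum⟩
    · have hsum : ((a - 1, b + 1) : ℤ × ℤ) + (a + 1, b - 1) = (2 * a, 2 * b) := by
        ext <;> simp only [Prod.fst_add, Prod.snd_add] <;> ring
      refine ⟨((a - 1, b + 1), (a + 1, b - 1)), ⟨?_, ?_, ?_, ?_⟩, hsum⟩
      · simp only [NbarMem, Ntilde, Int.odd_iff, Int.even_iff, abs_le]
        omega
      · simp only [NbarMem, Ntilde, Int.odd_iff, Int.even_iff, abs_le]
        omega
      · right
        ext <;> simp only [Prod.fst_sub, Prod.snd_sub] <;> ring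
      · rintro ⟨v, w, hw, hvw⟩
        exact h4 ⟨v, w, hw, hvw.trans hsum⟩

lemma injOn_sum_dualForest (n : ℤ) (F : ℤ × ℤ → Option (ℤ × ℤ)) :
    Set.InjOn (fun e : (ℤ × ℤ) × (ℤ × ℤ) => e.1 + e.2) (dualForest n F) := by
  rintro ⟨⟨a, b⟩, ⟨c, d⟩⟩ ⟨⟨h1, -⟩, -, h2, -⟩ ⟨⟨a', b'⟩, ⟨c', d'⟩⟩ ⟨⟨h1', -⟩, -, h2', -⟩ h
  simp only [Ntilde, Set.mem_insert_iff, Set.mem_singleton_iff, Prod.mk_sub_mk,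
    Prod.mk_add_mk, Prod.mk.injEq, Int.odd_iff, Int.even_iff] at *
  omega

lemma IsDCF.ncard_dualForest {n : ℤ} (hn4 : 4 ∣ n) {F : ℤ × ℤ → Option (ℤ × ℤ)}
    (hF : IsDCF n F) :
    (dualForest n F).ncard = {v | Ntilde v ∧ |v.1| ≤ n ∧ |v.2| ≤ n}.ncard := by
  have hfin : (edgeSums n).Finite := (finite_box (2 * n) (2 * n)).subset fun p h => h.2
  rw [← (injOn_sum_dualForest n F).ncard_image, image_sum_dualForest hn4,
    Set.ncard_sdiff hF.sums_subset_edgeSums (hfin.subset hF.sums_subset_edgeSums),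
    hF.ncard_sums, ncard_edgeSums, Nat.add_sub_cancel_right]

lemma ncard_nbarMem {n : ℤ} (hn : 0 < n) (hn4 : 4 ∣ n) : {v | NbarMem n v}.ncard =
    {v | Ntilde v ∧ |v.1| ≤ n ∧ |v.2| ≤ n}.ncard + (n + 1).toNat := by
  let f : ℤ → ℤ × ℤ := fun j => (if 4 ∣ 2 * j - n then -(n + 1) else n + 1, 2 * j - n)
  have hinj : Function.Injective f := by
    intro i j h
    have := congrArg Prod.snd h
    simp only [f] at this
    omega
  have hcard : (f '' (Finset.Icc 0 n : Finset ℤ)).ncard = (n + 1).toNat := by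
    rw [Set.ncard_image_of_injective _ hinj, Set.ncard_coe_finset, Int.card_Icc, sub_zero]
  rw [← hcard, ← Set.ncard_union_eq _ ((finite_box n n).subset fun v h => h.2)
    ((Finset.finite_toSet _).image f)]
  · congr 1
    ext ⟨x, y⟩
    simp only [NbarMem, Ntilde, Int.odd_iff, Int.even_iff, abs_le, Set.mem_union, Set.mem_image,
      Set.mem_ofPred_eq, Finset.coe_Icc, Set.mem_Icc, Prod.mk.injEq, f]
    constructor
    · intro h
      by_cases hx : -n ≤ x ∧ x ≤ n
      · left
        omega
      · right
        exact ⟨(y + n) / 2, by omega, by split_ifs <;> omega, by omega⟩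
    · rintro (h | ⟨j, hj, hx, rfl⟩)
      · omega
      · split_ifs at hx <;> omega
  · rw [Set.disjoint_left]
    rintro v ⟨-, h, -⟩ ⟨j, -, rfl⟩
    simp only [f, abs_le] at h
    split_ifs at h <;> omega

/-- In a finite forest, the vertices are counted by the edges and the components. -/
lemma SimpleGraph.IsAcyclic.card_edgeSet_add_card_connectedComponent {V : Type*} [Finite V]
    {G : SimpleGraph V} (hG : G.IsAcyclic) :
    Nat.card G.edgeSet + Nat.card G.ConnectedComponent = Nat.card V := by
  classical
  have := Fintype.ofFinite V
  have hdeg (c : G.ConnectedComponent) :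
      ∑ v : c, G.degree v + 2 = 2 * Fintype.card c := by
    have htree := (hG.isTree_connectedComponent c).card_edgeFinset
    have hsum := c.toSimpleGraph.sum_degrees_eq_twice_card_edges
    have hloc (v : c) : c.toSimpleGraph.degree v = G.degree v := by
      rw [← SimpleGraph.degree_induce_of_neighborSet_subset (G := G) (s := c.supp) (v := v)]
      · unfold SimpleGraph.ConnectedComponent.toSimpleGraph
        congr!
      · intro w hw
        exact c.mem_supp_of_adj_mem_supp v.2 hw
    simp only [hloc] at hsum
    omega
  have hV : ∑ c : G.ConnectedComponent, Fintype.card c = Fintype.card V := by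
    rw [← Fintype.card_sigma]
    exact Fintype.card_congr (Equiv.sigmaFiberEquiv G.connectedComponentMk)
  have hE : ∑ c : G.ConnectedComponent, ∑ v : c, G.degree v = ∑ v, G.degree v := by
    rw [← Fintype.sum_sigma']
    exact Fintype.sum_equiv (Equiv.sigmaFiberEquiv G.connectedComponentMk) _ _ fun _ => rfl
  have htotal := Finset.sum_congr rfl fun c (_ : c ∈ Finset.univ) => hdeg c
  rw [Finset.sum_add_distrib, ← Finset.mul_sum, hV, hE, G.sum_degrees_eq_twice_card_edges,
    Finset.sum_const, Finset.card_univ, smul_eq_mul] at htotal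
  rw [Nat.card_eq_fintype_card, Nat.card_eq_fintype_card, Nat.card_eq_fintype_card,
    ← SimpleGraph.edgeFinset_card]
  omega

/-- The dual forest as a simple graph on the north vertices. -/
def dualGraph (n : ℤ) (F : ℤ × ℤ → Option (ℤ × ℤ)) : SimpleGraph {v // NbarMem n v} where
  Adj a b := adjD n F a b
  symm := ⟨fun _ _ h => Or.symm h⟩
  loopless := ⟨fun a h => by have := h.spec; omega⟩

lemma isAcyclic_dualGraph {n : ℤ} (hn : 0 < n) (hn4 : 4 ∣ n) {F : ℤ × ℤ → Option (ℤ × ℤ)}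
    (hF : IsDCF n F) : (dualGraph n F).IsAcyclic := by
  intro v p hp
  refine not_cycle_adjD hn hn4 hF hp.three_le_length (s := fun i => (p.getVert i).1)
    (by simp) ?_ fun i hi => p.adj_getVert_succ hi
  intro i j hi hj h
  exact hp.getVert_injOn' (by simp only [Set.mem_ofPred_eq]; omega)
    (by simp only [Set.mem_ofPred_eq]; omega) (Subtype.ext h)

lemma card_edgeSet_dualGraph (n : ℤ) (F : ℤ × ℤ → Option (ℤ × ℤ)) :
    Nat.card (dualGraph n F).edgeSet = (dualForest n F).ncard := by
  rw [Nat.card_coe_set_eq]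
  symm
  refine Set.ncard_congr (fun e he => s(⟨e.1, he.1⟩, ⟨e.2, he.2.1⟩)) ?_ ?_ ?_
  · intro e he
    exact Or.inl he
  · rintro ⟨⟨a, b⟩, ⟨c, d⟩⟩ ⟨⟨a', b'⟩, ⟨c', d'⟩⟩ he he' heq
    obtain ⟨-, -, h, -⟩ := id he
    obtain ⟨-, -, h', -⟩ := id he'
    have heq' := Sym2.eq_iff.1 heq
    simp only [Set.mem_insert_iff, Set.mem_singleton_iff, Prod.mk_sub_mk, Prod.mk.injEq,
      Subtype.mk.injEq] at heq' h h' ⊢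
    omega
  · intro e
    induction e with
    | _ a b =>
      rintro (h | h)
      · exact ⟨_, h, rfl⟩
      · exact ⟨_, h, Sym2.eq_swap⟩

lemma reachable_dualGraph_iff {n : ℤ} {F : ℤ × ℤ → Option (ℤ × ℤ)} (a b : {v // NbarMem n v}) :
    (dualGraph n F).Reachable a b ↔ Relation.ReflTransGen (adjD n F) a b := by
  rw [SimpleGraph.reachable_iff_reflTransGen]
  constructor
  · exact fun h => h.lift Subtype.val fun _ _ h => h
  · have key (c : ℤ × ℤ) (h : Relation.ReflTransGen (adjD n F) a c) (hc : NbarMem n c) :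
        Relation.ReflTransGen (dualGraph n F).Adj a ⟨c, hc⟩ := by
      induction h with
      | refl => exact Relation.ReflTransGen.refl
      | tail _ hbc ih => exact (ih hbc.spec.1).tail hbc
    exact fun h => key b h b.2

lemma ncard_components_eq (n : ℤ) (F : ℤ × ℤ → Option (ℤ × ℤ)) :
    {C : Set (ℤ × ℤ) | ∃ v, NbarMem n v ∧
        C = {u | NbarMem n u ∧ Relation.ReflTransGen (adjD n F) v u}}.ncard =
      Nat.card (dualGraph n F).ConnectedComponent := by
  have hinj : Function.Injective
      fun c : (dualGraph n F).ConnectedComponent => Subtype.val '' c.supp :=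
    Subtype.val_injective.image_injective.comp SimpleGraph.ConnectedComponent.supp_injective
  rw [← Set.ncard_univ, ← Set.ncard_image_of_injective _ hinj, Set.image_univ]
  congr 1
  have hsupp (v : {v // NbarMem n v}) :
      Subtype.val '' ((dualGraph n F).connectedComponentMk v).supp =
        {u | NbarMem n u ∧ Relation.ReflTransGen (adjD n F) v u} := by
    ext u
    simp only [Set.mem_image, SimpleGraph.ConnectedComponent.mem_supp_iff,
      SimpleGraph.ConnectedComponent.eq, Set.mem_ofPred_eq]
    constructor
    · rintro ⟨u, h, rfl⟩
      exact ⟨u.2, (reachable_dualGraph_iff _ _).1 h.symm⟩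
    · rintro ⟨hu, h⟩
      exact ⟨⟨u, hu⟩, ((reachable_dualGraph_iff v ⟨u, hu⟩).2 h).symm, rfl⟩
  ext C
  constructor
  · rintro ⟨v, hv, rfl⟩
    exact ⟨_, hsupp ⟨v, hv⟩⟩
  · rintro ⟨c, rfl⟩
    induction c using SimpleGraph.ConnectedComponent.ind with
    | _ v => exact ⟨v, v.2, hsupp v⟩

theorem stmt7 (n : ℤ) (hn : 0 < n) (hn4 : 4 ∣ n)
    (F : ℤ × ℤ → Option (ℤ × ℤ)) (hF : IsDCF n F) :
    -- no cycles
    (∀ k : ℕ, 3 ≤ k → ∀ s : ℕ → ℤ × ℤ, s k = s 0 →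
      (∀ i j, i < k → j < k → s i = s j → i = j) →
      ¬(∀ i < k, adjD n F (s i) (s (i + 1)))) ∧
    -- the number of dual edges equals the number of interior north vertices
    (dualForest n F).ncard = {v | Ntilde v ∧ |v.1| ≤ n ∧ |v.2| ≤ n}.ncard ∧
    -- hence there are exactly `n + 1 = |∂ˣN|` connected components
    {C : Set (ℤ × ℤ) | ∃ v, NbarMem n v ∧
        C = {u | NbarMem n u ∧ Relation.ReflTransGen (adjD n F) v u}}.ncard
      = (n + 1).toNat := by
  refine ⟨fun k hk s hclosed hinj => not_cycle_adjD hn hn4 hF hk hclosed hinj,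
    hF.ncard_dualForest hn4, ?_⟩
  have : Finite {v // NbarMem n v} := (finite_box (n + 1) n).subset fun v hv => hv.2
  have hcount := (isAcyclic_dualGraph hn hn4 hF).card_edgeSet_add_card_connectedComponent
  have hV := ncard_nbarMem hn hn4
  rw [card_edgeSet_dualGraph, hF.ncard_dualForest hn4] at hcount
  rw [← Nat.card_coe_set_eq] at hV
  rw [ncard_components_eq]
  exact Nat.add_left_cancel (hcount.trans hV)
end
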